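/- Let x ∈ 𝒟 satisfy E_f(x) < min{ 1/a , 2/(b + √(b² + 4ab)) }, where a = (n−1)^{1/q} and b = 2^{1/q}. Then the vector x̂ = 𝒯(x) has pairwise distinct components, 1 − σ_i(x) ≠ 0 for every i, and for each i the Weierstrass correction at x̂ satisfies the exact identity W_i(x̂) = ((x_i − x̂_i)·(σ_i(x) − σ̂_i(x) + σ_i(x)·σ̂_i(x))/(1 − σ_i(x))) · ∏_{j≠i} (x̂_i − x_j)/(x̂_i − x̂_j), where σ̂_i(x) = Σ_{j≠i} W_j(x)/(x̂_i − x_j). (Lemma 4.3) -/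

import Mathlib

open Finset Polynomial Filter

noncomputable section

/-- The Weierstrass correction `W_i(x) = f(x_i)/(C₀ ∏_{j≠i}(x_i − x_j))`. -/
def Wc {n : ℕ} {K : Type*} [NormedField K] (f : Polynomial K) (x : Fin n → K) (i : Fin n) : K :=
  eval (x i) f / (f.leadingCoeff * ∏ j ∈ univ.erase i, (x i - x j))

/-- `dmin x i = min_{j ≠ i} ‖x i - x j‖`. -/
def dmin {n : ℕ} {K : Type*} [NormedField K] (x : Fin n → K) (i : Fin n) : ℝ :=
  if h : (univ.erase i).Nonempty then (univ.erase i).inf' h fun j => ‖x i - x j‖ else 0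

/-- `E_f(x)` : the ℓ^p norm of the vector `(‖W_i(x)‖ / d_i(x))_i`. -/
def Ef {n : ℕ} {K : Type*} [NormedField K] (p : ENNReal) (f : Polynomial K)
    (x : Fin n → K) : ℝ :=
  ‖(WithLp.equiv p (Fin n → ℝ)).symm (fun i => ‖Wc f x i‖ / dmin x i)‖

/-- `σ_i(x) = Σ_{j≠i} W_j(x)/(x_i − x_j)`. -/
def sigmaf {n : ℕ} {K : Type*} [NormedField K] (f : Polynomial K) (x : Fin n → K)
    (i : Fin n) : K :=
  ∑ j ∈ univ.erase i, Wc f x j / (x i - x j)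

/-- The Ehrlich iteration function. -/
def PhiE {n : ℕ} {K : Type*} [NormedField K] (f : Polynomial K) (x : Fin n → K) : Fin n → K :=
  fun i => x i - Wc f x i / (1 + sigmaf f x i)

/-- The Prešić–Tanabe iteration function. -/
def TnbE {n : ℕ} {K : Type*} [NormedField K] (f : Polynomial K) (x : Fin n → K) : Fin n → K :=
  fun i => x i - Wc f x i * (1 - sigmaf f x i)

/-- `ξ` is a root vector of `f`, i.e. `f(z) = C₀ ∏ (z − ξᵢ)`. -/
def IsRootVector {n : ℕ} {K : Type*} [NormedField K] (f : Polynomial K) (ξ : Fin n → K) : Prop :=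
  f = C f.leadingCoeff * ∏ i, (X - C (ξ i))

/-- `E_f(x)` in the case `p = ∞`: the max of `‖W_i(x)‖ / d_i(x)`. -/
def Einf {n : ℕ} {K : Type*} [NormedField K] (f : Polynomial K) (x : Fin n → K) : ℝ :=
  if h : (univ : Finset (Fin n)).Nonempty then univ.sup' h fun i => ‖Wc f x i‖ / dmin x i else 0

/-- Hölder's inequality between a partial sum of nonnegative reals and the `ℓ^p` norm. -/
theorem sum_le_card_rpow_mul_norm_toLp {ι : Type*} [Fintype ι] {p q : ENNReal} (hp : 1 ≤ p)
    (hpq : p⁻¹ + q⁻¹ = 1) (s : Finset ι) (v : ι → ℝ) (hv : ∀ i, 0 ≤ v i) :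
    ∑ i ∈ s, v i ≤ (#s : ℝ) ^ ENNReal.toReal q⁻¹ * ‖WithLp.toLp p v‖ := by
  rcases eq_or_ne p ⊤ with rfl | hpt
  · have hq : q⁻¹ = 1 := by simpa using hpq
    rw [hq, ENNReal.toReal_one, Real.rpow_one, PiLp.norm_eq_ciSup, ← nsmul_eq_mul]
    refine Finset.sum_le_card_nsmul _ _ _ fun i _ => ?_
    refine (le_abs_self (v i)).trans ?_
    exact le_ciSup (f := fun i => ‖v i‖) (Set.finite_range _).bddAbove i
  · have hP : 1 ≤ p.toReal := by
      simpa using ENNReal.toReal_mono hpt hp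
    have hP0 : 0 < p.toReal := by linarith
    have hq : ENNReal.toReal q⁻¹ = 1 - 1 / p.toReal := by
      have hqt : q⁻¹ ≠ ⊤ := by
        intro h
        simp [h] at hpq
      have hpt' : p⁻¹ ≠ ⊤ := ENNReal.inv_ne_top.2 (zero_lt_one.trans_le hp).ne'
      have h := congrArg ENNReal.toReal hpq
      rw [ENNReal.toReal_add hpt' hqt, ENNReal.toReal_inv, ENNReal.toReal_one] at h
      rw [one_div]
      linarith
    have hs : 0 ≤ ∑ i ∈ s, v i := Finset.sum_nonneg fun i _ => hv i
    have hT : 0 ≤ ∑ i, v i ^ p.toReal :=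
      Finset.sum_nonneg fun i _ => Real.rpow_nonneg (hv i) _
    have hpow : (∑ i ∈ s, v i) ^ p.toReal ≤
        (#s : ℝ) ^ (p.toReal - 1) * ∑ i, v i ^ p.toReal := by
      refine (Real.rpow_sum_le_const_mul_sum_rpow_of_nonneg s hP fun i _ => hv i).trans ?_
      refine mul_le_mul_of_nonneg_left ?_ (by positivity)
      exact Finset.sum_le_univ_sum_of_nonneg fun i => Real.rpow_nonneg (hv i) _
    have hroot := Real.rpow_le_rpow (by positivity) hpow (one_div_nonneg.2 hP0.le)
    rw [← Real.rpow_mul hs, mul_one_div_cancel hP0.ne', Real.rpow_one,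
      Real.mul_rpow (by positivity) hT, ← Real.rpow_mul (by positivity)] at hroot
    rw [PiLp.norm_eq_sum hP0, hq]
    have he : (p.toReal - 1) * (1 / p.toReal) = 1 - 1 / p.toReal := by
      field_simp
    rw [he] at hroot
    simpa only [PiLp.toLp_apply, Real.norm_of_nonneg (hv _)] using hroot

/-- A number below the positive root of `a b t² + b t - 1` makes that quadratic negative. -/
theorem mul_mul_one_add_mul_lt_one {a b t : ℝ} (ha : 0 ≤ a) (hb : 0 < b) (ht : 0 ≤ t)
    (h : t < 2 / (b + √(b ^ 2 + 4 * a * b))) : b * t * (1 + a * t) < 1 := by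
  set r := √(b ^ 2 + 4 * a * b) with hr
  have hr0 : 0 ≤ r := Real.sqrt_nonneg _
  have hr2 : r ^ 2 = b ^ 2 + 4 * a * b := Real.sq_sqrt (by positivity)
  rw [lt_div_iff₀ (by positivity)] at h
  have hrt : r * t < 2 - b * t := by linarith
  have hsq : (r * t) ^ 2 < (2 - b * t) ^ 2 := pow_lt_pow_left₀ hrt (by positivity) two_ne_zero
  rw [mul_pow, hr2] at hsq
  nlinarith

section Weierstrass

variable {n : ℕ} {K : Type*} [NormedField K]

theorem dmin_le (x : Fin n → K) {i j : Fin n} (hij : j ≠ i) : dmin x i ≤ ‖x i - x j‖ := by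
  have hj : j ∈ univ.erase i := by simp [hij]
  have hne : (univ.erase i).Nonempty := ⟨j, hj⟩
  rw [dmin, dif_pos hne]
  exact Finset.inf'_le _ hj

theorem dmin_pos {x : Fin n → K} (hx : Function.Injective x) {i j : Fin n} (hij : j ≠ i) :
    0 < dmin x i := by
  have hj : j ∈ univ.erase i := by simp [hij]
  have hne : (univ.erase i).Nonempty := ⟨j, hj⟩
  rw [dmin, dif_pos hne, Finset.lt_inf'_iff]
  intro k hk
  exact norm_pos_iff.2 (sub_ne_zero.2 (hx.ne (Finset.ne_of_mem_erase hk).symm))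

theorem dmin_nonneg (x : Fin n → K) (i : Fin n) : 0 ≤ dmin x i := by
  rw [dmin]
  split_ifs with h
  · exact (Finset.le_inf'_iff h _).2 fun _ _ => norm_nonneg _
  · exact le_rfl

theorem norm_Wc_le (f : K[X]) {x : Fin n → K} (hx : Function.Injective x) {i j : Fin n}
    (hij : j ≠ i) : ‖Wc f x i‖ ≤ ‖Wc f x i‖ / dmin x i * ‖x i - x j‖ := by
  have hd := dmin_pos hx hij
  rw [div_mul_eq_mul_div, le_div_iff₀ hd]
  exact mul_le_mul_of_nonneg_left (dmin_le x hij) (norm_nonneg _)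

theorem norm_sigmaf_le (f : K[X]) {x : Fin n → K} (hx : Function.Injective x) (i : Fin n) :
    ‖sigmaf f x i‖ ≤ ∑ j ∈ univ.erase i, ‖Wc f x j‖ / dmin x j := by
  refine (norm_sum_le _ _).trans (Finset.sum_le_sum fun j hj => ?_)
  have hij : i ≠ j := (Finset.ne_of_mem_erase hj).symm
  rw [norm_div, norm_sub_rev]
  exact div_le_div_of_nonneg_left (norm_nonneg _) (dmin_pos hx hij) (dmin_le x hij)

/-- Lagrange interpolation of `f` at `n = deg f` nodes, in terms of Weierstrass corrections. -/
theorem eval_eq_mul_one_add_sum_Wc {f : K[X]} (hdeg : f.degree = (n : ℕ)) {x : Fin n → K}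
    (hx : Function.Injective x) {z : K} (hz : ∀ j, z ≠ x j) :
    eval z f = f.leadingCoeff * (∏ j, (z - x j)) * (1 + ∑ j, Wc f x j / (z - x j)) := by
  have hf : f ≠ 0 := by
    rintro rfl
    simp at hdeg
  have hC : f.leadingCoeff ≠ 0 := leadingCoeff_ne_zero.2 hf
  set N : K[X] := C f.leadingCoeff * Lagrange.nodal univ x with hN
  have hNdeg : N.degree = f.degree := by
    rw [hN, degree_C_mul hC, Lagrange.degree_nodal, hdeg, Finset.card_univ, Fintype.card_fin]
  have hNlead : N.leadingCoeff = f.leadingCoeff := by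
    rw [hN, leadingCoeff_mul, leadingCoeff_C, Lagrange.nodal_monic, mul_one]
  have hlt : (f - N).degree < #(univ : Finset (Fin n)) := by
    rw [Finset.card_univ, Fintype.card_fin, ← hdeg]
    exact degree_sub_lt_left hNdeg.symm hf hNlead.symm
  have heval : ∀ i ∈ (univ : Finset (Fin n)), eval (x i) (f - N) = eval (x i) f := by
    intro i hi
    simp [hN, Lagrange.eval_nodal_at_node hi]
  have hinterp := Lagrange.eq_interpolate_of_eval_eq (fun i => eval (x i) f)
    (hx.injOn (s := ((univ : Finset (Fin n)) : Set (Fin n)))) hlt heval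
  have hz' := congrArg (eval z) hinterp
  rw [Lagrange.eval_interpolate_not_at_node _ fun i _ => hz i, eval_sub, hN, eval_mul, eval_C,
    Lagrange.eval_nodal] at hz'
  rw [sub_eq_iff_eq_add'.1 hz', mul_add, mul_one, mul_comm f.leadingCoeff, mul_assoc]
  congr 2
  rw [Finset.mul_sum]
  refine Finset.sum_congr rfl fun j _ => ?_
  rw [Lagrange.nodalWeight, Wc, Finset.prod_inv_distrib]
  field_simp

/-- The displacement of a node under `TnbE`, relative to its distance to another node. -/
theorem norm_sub_TnbE_le (f : K[X]) {x : Fin n → K} (hx : Function.Injective x) {i j : Fin n}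
    (hij : j ≠ i) {c : ℝ} (hc : ‖sigmaf f x i‖ ≤ c) :
    ‖x i - TnbE f x i‖ ≤ ‖Wc f x i‖ / dmin x i * (1 + c) * ‖x i - x j‖ := by
  have h1 : ‖1 - sigmaf f x i‖ ≤ 1 + c := by
    refine (norm_sub_le _ _).trans ?_
    rw [norm_one]
    linarith
  rw [TnbE, sub_sub_cancel, norm_mul, mul_right_comm]
  have h0 := norm_Wc_le f hx hij
  exact mul_le_mul h0 h1 (norm_nonneg _) ((norm_nonneg _).trans h0)

/-- The Weierstrass correction at `TnbE f x`, once the relevant denominators are nonzero. -/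
theorem Wc_TnbE {f : K[X]} (hdeg : f.degree = (n : ℕ)) {x : Fin n → K}
    (hx : Function.Injective x) {i : Fin n} (hσ : 1 - sigmaf f x i ≠ 0)
    (hne : ∀ j, j ≠ i → TnbE f x i ≠ x j) :
    Wc f (TnbE f x) i =
      (x i - TnbE f x i) *
        (sigmaf f x i - (∑ j ∈ univ.erase i, Wc f x j / (TnbE f x i - x j)) +
          sigmaf f x i * ∑ j ∈ univ.erase i, Wc f x j / (TnbE f x i - x j)) /
        (1 - sigmaf f x i) *
        ∏ j ∈ univ.erase i, (TnbE f x i - x j) / (TnbE f x i - TnbE f x j) := by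
  have hf : f ≠ 0 := by
    rintro rfl
    simp at hdeg
  have hC : f.leadingCoeff ≠ 0 := leadingCoeff_ne_zero.2 hf
  have hstep : x i - TnbE f x i = Wc f x i * (1 - sigmaf f x i) := by
    rw [TnbE, sub_sub_cancel]
  by_cases hW : Wc f x i = 0
  · have hxi : TnbE f x i = x i := by simp [TnbE, hW]
    have hP : ∏ j ∈ univ.erase i, (x i - x j) ≠ 0 :=
      Finset.prod_ne_zero_iff.2 fun j hj =>
        sub_ne_zero.2 (hx.ne (Finset.ne_of_mem_erase hj).symm)
    have hroot : eval (x i) f = 0 := by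
      rw [Wc, div_eq_zero_iff] at hW
      exact hW.resolve_right (mul_ne_zero hC hP)
    rw [Wc, hxi, hroot]
    simp
  · have hne' : ∀ j, TnbE f x i ≠ x j := by
      intro j
      rcases eq_or_ne j i with rfl | hj
      · intro h
        rw [h, sub_self] at hstep
        exact mul_ne_zero hW hσ hstep.symm
      · exact hne j hj
    have hzi : TnbE f x i - x i ≠ 0 := sub_ne_zero.2 (hne' i)
    rw [Wc, eval_eq_mul_one_add_sum_Wc hdeg hx hne', Finset.prod_div_distrib,
      ← Finset.mul_prod_erase univ _ (Finset.mem_univ i),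
      ← Finset.add_sum_erase univ _ (Finset.mem_univ i), mul_assoc f.leadingCoeff,
      mul_div_mul_left _ _ hC, mul_div_assoc']
    congr 1
    have hWi : Wc f x i = (x i - TnbE f x i) / (1 - sigmaf f x i) := by
      rw [hstep, mul_div_cancel_right₀ _ hσ]
    rw [hWi, ← neg_sub (TnbE f x i) (x i)]
    generalize TnbE f x i - x i = t at *
    field_simp
    ring

end Weierstrass

/-- Proinov, Lemma 4.3. -/
theorem stmt_16 {n : ℕ} {K : Type*} [NormedField K] [CompleteSpace K] (hn : 2 ≤ n)
    (f : Polynomial K) (hdeg : f.degree = (n : ℕ))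
    (p q : ENNReal) (hp : 1 ≤ p) (hpq : p⁻¹ + q⁻¹ = 1)
    (a b : ℝ) (ha : a = ((n : ℝ) - 1) ^ (ENNReal.toReal q⁻¹))
    (hb : b = (2 : ℝ) ^ (ENNReal.toReal q⁻¹))
    (x : Fin n → K) (hx : Function.Injective x)
    (hE : Ef p f x < min (1 / a) (2 / (b + Real.sqrt (b ^ 2 + 4 * a * b)))) :
    Function.Injective (TnbE f x) ∧
    (∀ i : Fin n, (1 : K) - sigmaf f x i ≠ 0) ∧
    ∀ i : Fin n,
      Wc f (TnbE f x) i =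
        (x i - TnbE f x i) *
          (sigmaf f x i - (∑ j ∈ univ.erase i, Wc f x j / (TnbE f x i - x j)) +
            sigmaf f x i * ∑ j ∈ univ.erase i, Wc f x j / (TnbE f x i - x j)) /
          (1 - sigmaf f x i) *
          ∏ j ∈ univ.erase i, (TnbE f x i - x j) / (TnbE f x i - TnbE f x j) := by
  have hn1 : (1 : ℝ) ≤ (n : ℝ) - 1 := by
    have : (2 : ℝ) ≤ n := by exact_mod_cast hn
    linarith
  have ha0 : 0 < a := ha ▸ Real.rpow_pos_of_pos (by linarith) _
  have hb1 : 1 ≤ b := hb ▸ Real.one_le_rpow one_le_two ENNReal.toReal_nonneg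
  set w : Fin n → ℝ := fun i => ‖Wc f x i‖ / dmin x i with hw
  have hw0 : ∀ i, 0 ≤ w i := fun i => div_nonneg (norm_nonneg _) (dmin_nonneg x i)
  set E : ℝ := Ef p f x with hEdef
  have hholder : ∀ s : Finset (Fin n), ∑ i ∈ s, w i ≤ (#s : ℝ) ^ ENNReal.toReal q⁻¹ * E :=
    fun s => sum_le_card_rpow_mul_norm_toLp hp hpq s w hw0
  have hE0 : 0 ≤ E := by
    have h := (hw0 _).trans_eq (Finset.sum_singleton w ⟨0, by omega⟩).symm
    simpa using h.trans (hholder _)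
  have hσ : ∀ i, ‖sigmaf f x i‖ ≤ a * E := by
    intro i
    refine (norm_sigmaf_le f hx i).trans ((hholder _).trans_eq ?_)
    rw [Finset.card_erase_of_mem (Finset.mem_univ i), Finset.card_univ, Fintype.card_fin,
      Nat.cast_pred (by omega), ha]
  have haE : a * E < 1 := by
    have h := hE.trans_le (min_le_left _ _)
    rwa [lt_div_iff₀ ha0, mul_comm] at h
  have hbE : b * E * (1 + a * E) < 1 :=
    mul_mul_one_add_mul_lt_one ha0.le (by linarith) hE0 (hE.trans_le (min_le_right _ _))
  have hpair : ∀ i j, j ≠ i → w i + w j ≤ b * E := by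
    intro i j hij
    have h := hholder {i, j}
    rwa [Finset.sum_pair hij.symm, Finset.card_pair hij.symm, Nat.cast_ofNat, ← hb] at h
  have hc0 : 0 ≤ 1 + a * E := by positivity
  have hsep : ∀ i j, j ≠ i →
      ‖x i - TnbE f x i‖ + ‖x j - TnbE f x j‖ < ‖x i - x j‖ := by
    intro i j hij
    have hi := norm_sub_TnbE_le f hx hij (hσ i)
    have hj := norm_sub_TnbE_le f hx hij.symm (hσ j)
    rw [norm_sub_rev (x j) (x i)] at hj
    have hpos : 0 < ‖x i - x j‖ := norm_pos_iff.2 (sub_ne_zero.2 (hx.ne hij.symm))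
    calc ‖x i - TnbE f x i‖ + ‖x j - TnbE f x j‖
        ≤ w i * (1 + a * E) * ‖x i - x j‖ + w j * (1 + a * E) * ‖x i - x j‖ := add_le_add hi hj
      _ = (w i + w j) * (1 + a * E) * ‖x i - x j‖ := by ring
      _ ≤ b * E * (1 + a * E) * ‖x i - x j‖ := by gcongr; exact hpair i j hij
      _ < ‖x i - x j‖ := mul_lt_of_lt_one_left hpos hbE
  have hσ1 : ∀ i, 1 - sigmaf f x i ≠ 0 := by
    intro i h
    have h1 := (hσ i).trans_lt haE
    rw [← sub_eq_zero.1 h, norm_one] at h1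
    exact lt_irrefl _ h1
  refine ⟨fun i j hij => ?_, hσ1, fun i => Wc_TnbE hdeg hx (hσ1 i) fun j hij h => ?_⟩
  · by_contra hne
    refine (hsep i j (Ne.symm hne)).not_ge ?_
    rw [hij, norm_sub_rev (x j)]
    exact norm_sub_le_norm_sub_add_norm_sub _ _ _
  · have h1 := hsep i j hij
    rw [h] at h1
    linarith [norm_nonneg (x j - TnbE f x j)]
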